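/- The LIP-opening commutes with LIP-addition of a constant: for every constant c < M and every x ∈ G, γ_b(f ⊞ c)(x) = γ_b(f)(x) ⊞ c, where (f ⊞ c)(y) = f(y) ⊞ c pointwise. Moreover γ_b(f)(x) < M for all x. -/

import Mathlib

/-- LIP-addition: a ⊞ b = a + b - a·b/M. -/
noncomputable def lipAdd (M a b : ℝ) : ℝ := a + b - a * b / M

/-- LIP-difference (defined when b < M): a ⊟ b = M·(a - b)/(M - b). -/
noncomputable def lipSub (M a b : ℝ) : ℝ := M * (a - b) / (M - b)

/-- LIP-erosion of f by a structuring function a with support Da: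
ε_a(f)(x) = min_{h ∈ Da} ( f(x+h) ⊟ a(h) ). -/
noncomputable def lipErosion (M : ℝ) {G : Type*} [AddCommGroup G]
    (Da : Finset G) (hne : Da.Nonempty) (a f : G → ℝ) (x : G) : ℝ :=
  Da.inf' hne fun h => lipSub M (f (x + h)) (a h)

/-- LIP-dilation of f by a structuring function a with support Da:
δ_a(f)(x) = max_{h ∈ Da} ( f(x−h) ⊞ a(h) ). -/
noncomputable def lipDilation (M : ℝ) {G : Type*} [AddCommGroup G]
    (Da : Finset G) (hne : Da.Nonempty) (a f : G → ℝ) (x : G) : ℝ :=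
  Da.sup' hne fun h => lipAdd M (f (x - h)) (a h)

/-- LIP-opening: γ_b(f) = δ_b(ε_b(f)). -/
noncomputable def lipOpening (M : ℝ) {G : Type*} [AddCommGroup G]
    (Db : Finset G) (hne : Db.Nonempty) (b f : G → ℝ) : G → ℝ :=
  lipDilation M Db hne b (lipErosion M Db hne b f)

theorem lipAdd_monotone_left {M c : ℝ} (hM : 0 < M) (hc : c ≤ M) :
    Monotone fun a => lipAdd M a c := by
  intro a a' h
  have key : lipAdd M a' c - lipAdd M a c = (a' - a) * (M - c) / M := by
    unfold lipAdd
    field_simp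
    ring
  have : 0 ≤ (a' - a) * (M - c) / M :=
    div_nonneg (mul_nonneg (sub_nonneg.2 h) (sub_nonneg.2 hc)) hM.le
  exact sub_nonneg.1 (key ▸ this)

theorem lipAdd_lt {M a b : ℝ} (hM : 0 < M) (ha : a < M) (hb : b < M) : lipAdd M a b < M := by
  have key : M - lipAdd M a b = (M - a) * (M - b) / M := by
    unfold lipAdd
    field_simp
    ring
  have : 0 < (M - a) * (M - b) / M := div_pos (mul_pos (sub_pos.2 ha) (sub_pos.2 hb)) hM
  exact sub_pos.1 (key ▸ this)

theorem lipSub_lt {M a b : ℝ} (hM : 0 < M) (ha : a < M) (hb : b < M) : lipSub M a b < M := by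
  rw [lipSub, div_lt_iff₀ (sub_pos.2 hb)]
  exact mul_lt_mul_of_pos_left (sub_lt_sub_right ha b) hM

theorem lipAdd_right_comm (M a b c : ℝ) :
    lipAdd M (lipAdd M a b) c = lipAdd M (lipAdd M a c) b := by
  unfold lipAdd
  ring

theorem lipSub_lipAdd_comm {M a b : ℝ} (hM : 0 < M) (hb : b < M) (c : ℝ) :
    lipSub M (lipAdd M a c) b = lipAdd M (lipSub M a b) c := by
  have hMb : M - b ≠ 0 := (sub_pos.2 hb).ne'
  unfold lipSub lipAdd
  field_simp
  ring

section Operators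

variable {M : ℝ} {G : Type*} [AddCommGroup G] {D : Finset G} {b f : G → ℝ} {c : ℝ}

theorem lipErosion_lipAdd_const (hM : 0 < M) (hne : D.Nonempty) (hb : ∀ h ∈ D, b h < M)
    (hc : c ≤ M) (x : G) :
    lipErosion M D hne b (fun y => lipAdd M (f y) c) x = lipAdd M (lipErosion M D hne b f x) c :=
  (Finset.inf'_congr hne rfl fun h hh => lipSub_lipAdd_comm hM (hb h hh) c).trans
    (Finset.apply_inf'_eq_inf'_comp hne (fun a => lipAdd M a c)
      fun _ _ => (lipAdd_monotone_left hM hc).map_inf _ _).symm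

theorem lipDilation_lipAdd_const (hM : 0 < M) (hne : D.Nonempty) (hc : c ≤ M) (x : G) :
    lipDilation M D hne b (fun y => lipAdd M (f y) c) x =
      lipAdd M (lipDilation M D hne b f x) c :=
  (Finset.sup'_congr hne rfl fun _ _ => lipAdd_right_comm M _ c _).trans
    (Finset.apply_sup'_eq_sup'_comp hne (fun a => lipAdd M a c)
      fun _ _ => (lipAdd_monotone_left hM hc).map_sup _ _).symm

theorem lipErosion_lt (hM : 0 < M) (hne : D.Nonempty) (hb : ∀ h ∈ D, b h < M)
    (hf : ∀ x, f x < M) (x : G) : lipErosion M D hne b f x < M :=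
  (Finset.inf'_lt_iff hne).2 <| hne.imp fun h hh => ⟨hh, lipSub_lt hM (hf _) (hb h hh)⟩

theorem lipDilation_lt (hM : 0 < M) (hne : D.Nonempty) (hb : ∀ h ∈ D, b h < M)
    (hf : ∀ x, f x < M) (x : G) : lipDilation M D hne b f x < M :=
  (Finset.sup'_lt_iff hne).2 fun h hh => lipAdd_lt hM (hf _) (hb h hh)

end Operators

/-- the LIP-opening commutes with LIP-addition of a constant:
γ_b(f ⊞ c)(x) = γ_b(f)(x) ⊞ c; moreover γ_b(f)(x) < M for all x. -/
theorem lipOpening_lipAdd_const (M : ℝ) (hM : 0 < M) {G : Type*} [AddCommGroup G]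
    (Db : Finset G) (hne : Db.Nonempty) (b : G → ℝ) (hb : ∀ h ∈ Db, b h < M)
    (f : G → ℝ) (hf : ∀ x, f x < M) (c : ℝ) (hc : c < M) (x : G) :
    lipOpening M Db hne b (fun y => lipAdd M (f y) c) x =
      lipAdd M (lipOpening M Db hne b f x) c ∧
    lipOpening M Db hne b f x < M := by
  have herosion : lipErosion M Db hne b (fun y => lipAdd M (f y) c) =
      fun y => lipAdd M (lipErosion M Db hne b f y) c :=
    funext fun y => lipErosion_lipAdd_const hM hne hb hc.le y
  refine ⟨?_, lipDilation_lt hM hne hb (lipErosion_lt hM hne hb hf) x⟩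
  rw [lipOpening, herosion]
  exact lipDilation_lipAdd_const hM hne hc.le x
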